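/- Let N : ℝⁿ × ℝᵐ → (Fin n → Fin m → ℝ) be C¹ (N-connection coefficients N_iᵃ), and for each i ∈ Fin n define the N-adapted horizontal vector field e_i : ℝⁿ × ℝᵐ → ℝⁿ × ℝᵐ by e_i(x,y) = (δ_i, −(N_iᵃ(x,y))_a), where δ_i is the i-th standard basis vector of ℝⁿ. Then for all i, j ∈ Fin n and all (x,y), the Lie bracket [e_i, e_j](x,y) is the purely vertical vector (0, (Ω_{ij}ᵃ(x,y))_a), where Ω_{ij}ᵃ = ∂N_iᵃ/∂xʲ − ∂N_jᵃ/∂xⁱ + Σ_b N_iᵇ ∂N_jᵃ/∂yᵇ − Σ_b N_jᵇ ∂N_iᵃ/∂yᵇ is the N-connection curvature (Neijenhuis tensor) of N. -/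

import Mathlib

noncomputable section

/-- The Lie bracket of two N-adapted horizontal vector fields
`e_i = ∂/∂xⁱ − N_iᵃ ∂/∂yᵃ` is the purely vertical vector field whose components are the
N-connection curvature (Neijenhuis tensor) `Ω_{ij}ᵃ`. -/
theorem lieBracket_horizontal_eq_Ncurvature {n m : ℕ}
    (N : (Fin n → ℝ) × (Fin m → ℝ) → (Fin n → Fin m → ℝ))
    (hN : ContDiff ℝ 1 N)
    (e : Fin n → (Fin n → ℝ) × (Fin m → ℝ) → (Fin n → ℝ) × (Fin m → ℝ))
    (he : ∀ i u, e i u = (Pi.single i 1, fun a => -(N u i a)))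
    (Ω : Fin n → Fin n → Fin m → (Fin n → ℝ) × (Fin m → ℝ) → ℝ)
    (hΩ : ∀ i j a u, Ω i j a u =
      fderiv ℝ (fun w => N w i a) u (Pi.single j 1, 0)
      - fderiv ℝ (fun w => N w j a) u (Pi.single i 1, 0)
      + ∑ b, N u i b * fderiv ℝ (fun w => N w j a) u (0, Pi.single b 1)
      - ∑ b, N u j b * fderiv ℝ (fun w => N w i a) u (0, Pi.single b 1)) :
    ∀ (i j : Fin n) (u : (Fin n → ℝ) × (Fin m → ℝ)),
      VectorField.lieBracket ℝ (e i) (e j) u = (0, fun a => Ω i j a u) := by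
  intro i j u
  have hd : ∀ k a, DifferentiableAt ℝ (fun w => N w k a) u := by
    intro k a
    have h := (hN.differentiable (by norm_num)) u
    exact differentiableAt_pi.1 (differentiableAt_pi.1 h k) a
  have hf : ∀ k, HasFDerivAt (e k)
      ((0 : (Fin n → ℝ) × (Fin m → ℝ) →L[ℝ] (Fin n → ℝ)).prod
        (ContinuousLinearMap.pi fun a => -(fderiv ℝ (fun w => N w k a) u))) u := by
    intro k
    have hek : e k = fun w => ((Pi.single k 1 : Fin n → ℝ), fun a => -(N w k a)) :=
      funext (he k)
    rw [hek]
    refine (hasFDerivAt_const _ u).prodMk ?_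
    exact hasFDerivAt_pi.2 fun a => (hd k a).hasFDerivAt.neg
  have key : ∀ (L : (Fin n → ℝ) × (Fin m → ℝ) →L[ℝ] ℝ) (k : Fin n),
      L (Pi.single k 1, fun a => -(N u k a)) =
        L (Pi.single k 1, 0) - ∑ b, N u k b * L (0, Pi.single b 1) := by
    intro L k
    have h : ((Pi.single k 1, fun a => -(N u k a)) : (Fin n → ℝ) × (Fin m → ℝ)) =
        (Pi.single k 1, 0) - ∑ b, N u k b • ((0, Pi.single b 1) : (Fin n → ℝ) × (Fin m → ℝ)) := by
      ext c
      · simp [Prod.fst_sum]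
      · simp [Prod.snd_sum, Finset.sum_apply, Pi.single_apply]
    rw [h, map_sub, map_sum]
    simp only [map_smul, smul_eq_mul]
  rw [VectorField.lieBracket, (hf i).fderiv, (hf j).fderiv, he i u, he j u]
  ext a
  · simp
  · simp only [ContinuousLinearMap.prod_apply, Prod.snd_sub, Pi.sub_apply,
      ContinuousLinearMap.coe_pi', neg_apply, key, hΩ, mul_neg,
      Finset.sum_neg_distrib]
    ring
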